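/- For every integer m ≥ 1 and all reals θ > 0, a > −1, the unconstrained interpolating weight h̃ is integrable on [0,∞)^m with 0 < ∫_{[0,∞)^m} h̃(x) dx < ∞, and for every Borel measurable function φ : (0,∞) → [0,∞) one has ∫_{[0,∞)^m} φ(Σ_{i=1}^m x_i) h̃(x) dx = (1/Γ(d)) · (∫_{[0,∞)^m} h̃(x) dx) · ∫_0^∞ φ(r) r^{d−1} e^{−r} dr; that is, under the normalized unconstrained ensemble the trace r = Σ_i x_i is Gamma-distributed with density e^{−r} r^{d−1}/Γ(d). -/

import Mathlib

open Finset MeasureTheory Set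

noncomputable section

/-- The unconstrained interpolating weight on `[0,∞)^m`:
`h̃(x) = ∏_{i<j} ((x_i−x_j)/(x_i+x_j))·(x_i^θ−x_j^θ) · ∏_i x_i^a e^{−x_i}`. -/
def hWeight (m : ℕ) (θ a : ℝ) (x : Fin m → ℝ) : ℝ :=
  (∏ p ∈ Finset.univ.filter (fun p : Fin m × Fin m => p.1 < p.2),
      ((x p.1 - x p.2) / (x p.1 + x p.2) * (x p.1 ^ θ - x p.2 ^ θ)))
    * ∏ i, x i ^ a * Real.exp (-(x i))

/-- The positive orthant `[0,∞)^m`. -/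
def orthant (m : ℕ) : Set (Fin m → ℝ) := {x | ∀ i, 0 ≤ x i}

/-- The unconstrained average
`E_h[G] = (∫_{[0,∞)^m} G h̃)/(∫_{[0,∞)^m} h̃)`. -/
def Eh (m : ℕ) (θ a : ℝ) (G : (Fin m → ℝ) → ℝ) : ℝ :=
  (∫ x in orthant m, G x * hWeight m θ a x) / (∫ x in orthant m, hWeight m θ a x)

/-- The density (up to normalization) of the quantum interpolating ensemble:
`Ṽ(λ) = ∏_{i<j} ((λ_i−λ_j)/(λ_i+λ_j))·(λ_i^θ−λ_j^θ) · ∏_i λ_i^a`. -/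
def Vdens (m : ℕ) (θ a : ℝ) (lam : Fin m → ℝ) : ℝ :=
  (∏ p ∈ Finset.univ.filter (fun p : Fin m × Fin m => p.1 < p.2),
      ((lam p.1 - lam p.2) / (lam p.1 + lam p.2) * (lam p.1 ^ θ - lam p.2 ^ θ)))
    * ∏ i, lam i ^ a

/-- Parametrization of the probability simplex: the first `m−1` coordinates
are free and the last one is `1 −` their sum. -/
def simplexExt (m : ℕ) (lam : Fin (m - 1) → ℝ) : Fin m → ℝ :=
  fun i => if h : (i : ℕ) < m - 1 then lam ⟨i, h⟩ else 1 - ∑ j, lam j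

/-- The parameter domain `Δ = {λ ∈ [0,∞)^{m−1} : Σ λ_i ≤ 1}` of the simplex. -/
def simplexDom (m : ℕ) : Set (Fin (m - 1) → ℝ) :=
  {lam | (∀ i, 0 ≤ lam i) ∧ ∑ i, lam i ≤ 1}

/-- The constrained average over the quantum interpolating ensemble:
`E_f[G] = (∫_Δ G(λ) Ṽ(λ) dλ)/(∫_Δ Ṽ(λ) dλ)`, where `λ` runs over the simplex
parametrized by its first `m−1` coordinates. -/
def Ef (m : ℕ) (θ a : ℝ) (G : (Fin m → ℝ) → ℝ) : ℝ :=
  (∫ l in simplexDom m, G (simplexExt m l) * Vdens m θ a (simplexExt m l))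
    / (∫ l in simplexDom m, Vdens m θ a (simplexExt m l))

/-- The parameter `d = m(mθ − θ + 2a + 2)/2`. -/
def dPar (m : ℕ) (θ a : ℝ) : ℝ := m * (m * θ - θ + 2 * a + 2) / 2

/-- The digamma function `ψ₀ = Γ'/Γ`. -/
def psi0 (x : ℝ) : ℝ := deriv Real.Gamma x / Real.Gamma x

/-- Scaling of a power-weighted integral over `(0,∞)`. -/
lemma lintegral_Ioi_comp_mul_rpow (ψ : ℝ → ENNReal) (d : ℝ) {s : ℝ} (hs : 0 < s) :
    ∫⁻ c in Ioi (0 : ℝ), ψ (c * s) * ENNReal.ofReal (c ^ (d - 1) * s ^ d)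
      = ∫⁻ r in Ioi (0 : ℝ), ψ r * ENNReal.ofReal (r ^ (d - 1)) := by
  have himg : (fun c : ℝ => c * s) '' Ioi (0 : ℝ) = Ioi (0 : ℝ) := by
    ext r
    refine ⟨?_, fun hr => ⟨r / s, div_pos hr hs, by field_simp⟩⟩
    rintro ⟨c, hc, rfl⟩
    exact mul_pos hc hs
  conv_rhs => rw [← himg]
  rw [lintegral_image_eq_lintegral_abs_deriv_mul (f' := fun _ => s) measurableSet_Ioi
    (fun c _ => by simpa using ((hasDerivAt_id c).mul_const s).hasDerivWithinAt)
    (mul_left_injective₀ hs.ne').injOn]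
  refine setLIntegral_congr_fun measurableSet_Ioi fun c (hc : 0 < c) => ?_
  rw [mul_left_comm, ← ENNReal.ofReal_mul (abs_nonneg _), abs_of_pos hs,
    Real.mul_rpow hc.le hs.le, Real.rpow_sub_one hs.ne']
  congr 2
  field_simp

/-- The Gamma integral after the substitution `u = s / c`. -/
lemma lintegral_Ioi_inv_mul_rpow_mul_exp {d s : ℝ} (hd : 0 < d) (hs : 0 < s) :
    ∫⁻ c in Ioi (0 : ℝ), ENNReal.ofReal (c⁻¹ * ((c⁻¹ * s) ^ d * Real.exp (-(c⁻¹ * s))))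
      = ENNReal.ofReal (Real.Gamma d) := by
  have himg : (fun u : ℝ => s * u⁻¹) '' Ioi (0 : ℝ) = Ioi (0 : ℝ) := by
    ext c
    refine ⟨?_, fun (hc : 0 < c) => ⟨s / c, div_pos hs hc, by field_simp⟩⟩
    rintro ⟨u, hu, rfl⟩
    exact mul_pos hs (inv_pos.2 hu)
  have hinj : InjOn (fun u : ℝ => s * u⁻¹) (Ioi (0 : ℝ)) :=
    ((mul_right_injective₀ hs.ne').comp inv_injective).injOn
  conv_lhs => rw [← himg]
  rw [lintegral_image_eq_lintegral_abs_deriv_mul (f' := fun u => s * -(u ^ 2)⁻¹) measurableSet_Ioi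
    (fun u (hu : 0 < u) => ((hasDerivAt_inv hu.ne').const_mul s).hasDerivWithinAt) hinj,
    Real.Gamma_eq_integral hd,
    ofReal_integral_eq_lintegral_ofReal (Real.GammaIntegral_convergent hd)]
  · refine setLIntegral_congr_fun measurableSet_Ioi fun u (hu : 0 < u) => ?_
    have h : (s * u⁻¹)⁻¹ * s = u := by field_simp
    simp only [h]
    rw [← ENNReal.ofReal_mul (abs_nonneg _), mul_neg, abs_neg, abs_of_pos (by positivity),
      Real.rpow_sub_one hu.ne']
    congr 1
    field_simp
  · filter_upwards [self_mem_ae_restrict measurableSet_Ioi] with u (hu : 0 < u)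
    simp only [Pi.zero_apply]
    positivity

lemma lintegral_comp_smul_of_pos {m : ℕ} (G : (Fin m → ℝ) → ENNReal) (hG : Measurable G)
    {c : ℝ} (hc : 0 < c) :
    ∫⁻ x, G (c • x) = ENNReal.ofReal ((c ^ m)⁻¹) * ∫⁻ x, G x := by
  rw [← lintegral_map hG (measurable_const_smul c), Measure.map_addHaar_smul _ hc.ne',
    lintegral_smul_measure, Module.finrank_fin_fun, abs_of_pos (by positivity), smul_eq_mul]

/-- For a weight `w`, homogeneous of degree `d - m` and supported where the degree-one homogeneous
function `s` is positive, the distribution of `s` under `w x * exp (-s x)` is a multiple of the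
Gamma distribution of shape `d`. -/
lemma gamma_mul_lintegral_comp_mul_homogeneous {m : ℕ} {d : ℝ} (hd : 0 < d)
    {s : (Fin m → ℝ) → ℝ} (hs : Measurable s) (hs_smul : ∀ c x, s (c • x) = c * s x)
    {w : (Fin m → ℝ) → ENNReal} (hw : Measurable w)
    (hw_smul : ∀ c, 0 < c → ∀ x, w (c • x) = ENNReal.ofReal (c ^ (d - m)) * w x)
    (hws : ∀ x, w x ≠ 0 → 0 < s x) {ψ : ℝ → ENNReal} (hψ : Measurable ψ) :
    ENNReal.ofReal (Real.Gamma d) * ∫⁻ x, ψ (s x) * w x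
      = (∫⁻ x, w x * ENNReal.ofReal (Real.exp (-s x)))
        * ∫⁻ r in Ioi (0 : ℝ), ψ r * ENNReal.ofReal (r ^ (d - 1)) := by
  have key : ∫⁻ x, ∫⁻ c in Ioi (0 : ℝ), ψ (c * s x) * ENNReal.ofReal (c ^ (d - 1))
        * (w x * ENNReal.ofReal (s x ^ d * Real.exp (-s x)))
      = ∫⁻ y, ∫⁻ c in Ioi (0 : ℝ), ψ (s y) * w y
        * ENNReal.ofReal (c⁻¹ * ((c⁻¹ * s y) ^ d * Real.exp (-(c⁻¹ * s y)))) := by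
    rw [lintegral_lintegral_swap (by fun_prop)]
    conv_rhs => rw [lintegral_lintegral_swap (by fun_prop)]
    refine setLIntegral_congr_fun measurableSet_Ioi fun c (hc : 0 < c) => ?_
    have hG : Measurable fun y : Fin m → ℝ => ψ (s y) * w y
        * ENNReal.ofReal (c⁻¹ * ((c⁻¹ * s y) ^ d * Real.exp (-(c⁻¹ * s y)))) := by fun_prop
    have h := lintegral_comp_smul_of_pos _ hG hc
    have hcm : ENNReal.ofReal (c ^ m) * ENNReal.ofReal ((c ^ m)⁻¹) = 1 := by
      rw [← ENNReal.ofReal_mul (by positivity), mul_inv_cancel₀ (by positivity),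
        ENNReal.ofReal_one]
    rw [← one_mul (∫⁻ y, _ * ENNReal.ofReal (c⁻¹ * _)), ← hcm, mul_assoc, ← h,
      ← lintegral_const_mul' _ _ ENNReal.ofReal_ne_top]
    refine lintegral_congr fun x => ?_
    simp only [hs_smul, hw_smul c hc, inv_mul_cancel_left₀ hc.ne']
    have h1 : c ^ m * c ^ (d - m) * c⁻¹ = c ^ (d - 1) := by
      rw [← Real.rpow_natCast, ← Real.rpow_neg_one, ← Real.rpow_add hc, ← Real.rpow_add hc]
      ring_nf
    rw [← h1, ENNReal.ofReal_mul (by positivity), ENNReal.ofReal_mul (by positivity),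
      ENNReal.ofReal_mul (p := c⁻¹) (by positivity)]
    ring
  have hleft : ∀ x, ∫⁻ c in Ioi (0 : ℝ), ψ (c * s x) * ENNReal.ofReal (c ^ (d - 1))
        * (w x * ENNReal.ofReal (s x ^ d * Real.exp (-s x)))
      = w x * ENNReal.ofReal (Real.exp (-s x))
        * ∫⁻ r in Ioi (0 : ℝ), ψ r * ENNReal.ofReal (r ^ (d - 1)) := by
    intro x
    by_cases hx : w x = 0
    · simp [hx]
    have hsx := hws x hx
    rw [← lintegral_Ioi_comp_mul_rpow ψ d hsx, ← lintegral_const_mul _ (by fun_prop)]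
    refine setLIntegral_congr_fun measurableSet_Ioi fun c (hc : 0 < c) => ?_
    rw [ENNReal.ofReal_mul (by positivity), ENNReal.ofReal_mul (by positivity)]
    ring
  have hright : ∀ y, ∫⁻ c in Ioi (0 : ℝ), ψ (s y) * w y
        * ENNReal.ofReal (c⁻¹ * ((c⁻¹ * s y) ^ d * Real.exp (-(c⁻¹ * s y))))
      = ENNReal.ofReal (Real.Gamma d) * (ψ (s y) * w y) := by
    intro y
    by_cases hy : w y = 0
    · simp [hy]
    rw [lintegral_const_mul _ (by fun_prop), lintegral_Ioi_inv_mul_rpow_mul_exp hd (hws y hy),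
      mul_comm]
  rw [← lintegral_const_mul _ (by fun_prop), ← lintegral_mul_const _ (by fun_prop),
    ← lintegral_congr hleft, ← lintegral_congr hright, key]

lemma orthant_eq_pi_Ici (m : ℕ) : orthant m = univ.pi fun _ => Set.Ici 0 := by
  ext x
  simp [orthant, Pi.le_def]

lemma restrict_orthant (m : ℕ) :
    (volume : Measure (Fin m → ℝ)).restrict (orthant m)
      = volume.restrict (univ.pi fun _ => Set.Ioi 0) := by
  rw [orthant_eq_pi_Ici]
  exact (Measure.restrict_congr_set Measure.pi_Ioi_ae_eq_pi_Ici).symm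

lemma measurableSet_orthant (m : ℕ) : MeasurableSet (orthant m) := by
  rw [orthant_eq_pi_Ici]
  exact MeasurableSet.univ_pi fun _ => measurableSet_Ici

lemma measurable_Vdens (m : ℕ) (θ a : ℝ) : Measurable (Vdens m θ a) := by
  unfold Vdens
  fun_prop

lemma hWeight_eq_Vdens_mul_exp (m : ℕ) (θ a : ℝ) (x : Fin m → ℝ) :
    hWeight m θ a x = Vdens m θ a x * Real.exp (-∑ i, x i) := by
  rw [hWeight, Vdens, ← Finset.sum_neg_distrib, Real.exp_sum, mul_assoc, ← Finset.prod_mul_distrib]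

lemma measurable_hWeight (m : ℕ) (θ a : ℝ) : Measurable (hWeight m θ a) := by
  unfold hWeight
  fun_prop

lemma pair_factor_nonneg {θ x y : ℝ} (hθ : 0 < θ) (hx : 0 ≤ x) (hy : 0 ≤ y) :
    0 ≤ (x - y) / (x + y) * (x ^ θ - y ^ θ) := by
  rcases le_total x y with h | h
  · exact mul_nonneg_of_nonpos_of_nonpos
      (div_nonpos_of_nonpos_of_nonneg (sub_nonpos.2 h) (add_nonneg hx hy))
      (sub_nonpos.2 (Real.rpow_le_rpow hx h hθ.le))
  · exact mul_nonneg (div_nonneg (sub_nonneg.2 h) (add_nonneg hx hy))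
      (sub_nonneg.2 (Real.rpow_le_rpow hy h hθ.le))

lemma pair_factor_le {θ x y : ℝ} (hx : 0 ≤ x) (hy : 0 ≤ y) :
    |(x - y) / (x + y) * (x ^ θ - y ^ θ)| ≤ (1 + x ^ θ) * (1 + y ^ θ) := by
  have hxθ := Real.rpow_nonneg hx θ
  have hyθ := Real.rpow_nonneg hy θ
  have h1 : |(x - y) / (x + y)| ≤ 1 := by
    rw [abs_div, abs_of_nonneg (add_nonneg hx hy)]
    exact div_le_one_of_le₀ (abs_sub_le_iff.2 ⟨by linarith, by linarith⟩) (add_nonneg hx hy)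
  have h2 : |x ^ θ - y ^ θ| ≤ x ^ θ + y ^ θ :=
    abs_sub_le_iff.2 ⟨by linarith, by linarith⟩
  rw [abs_mul]
  nlinarith [mul_le_mul h1 h2 (abs_nonneg _) zero_le_one, mul_nonneg hxθ hyθ]

lemma Vdens_nonneg {m : ℕ} {θ : ℝ} (hθ : 0 < θ) (a : ℝ) {x : Fin m → ℝ} (hx : x ∈ orthant m) :
    0 ≤ Vdens m θ a x :=
  mul_nonneg (Finset.prod_nonneg fun p _ => pair_factor_nonneg hθ (hx p.1) (hx p.2))
    (Finset.prod_nonneg fun i _ => Real.rpow_nonneg (hx i) a)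

lemma hWeight_nonneg {m : ℕ} {θ : ℝ} (hθ : 0 < θ) (a : ℝ) {x : Fin m → ℝ} (hx : x ∈ orthant m) :
    0 ≤ hWeight m θ a x := by
  rw [hWeight_eq_Vdens_mul_exp]
  exact mul_nonneg (Vdens_nonneg hθ a hx) (Real.exp_nonneg _)

lemma card_filter_fst_lt_snd (m : ℕ) :
    ((Finset.univ.filter fun p : Fin m × Fin m => p.1 < p.2).card : ℝ) = m * (m - 1) / 2 := by
  have h : (Finset.univ.filter fun p : Fin m × Fin m => p.1 < p.2).card
      = ∑ i ∈ Finset.range m, (m - 1 - i) := by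
    rw [Finset.card_filter, Fintype.sum_prod_type, Finset.sum_range]
    refine Finset.sum_congr rfl fun i _ => ?_
    rw [← Finset.card_filter, ← Fin.card_Ioi]
    congr 1
    ext j
    simp
  rw [h, Finset.sum_range_reflect (fun i => i) m, eq_div_iff two_ne_zero]
  have := Finset.sum_range_id_mul_two m
  cases m with
  | zero => simp
  | succ k =>
    rw [Nat.add_sub_cancel] at this
    have hcast := congrArg (Nat.cast (R := ℝ)) this
    push_cast at hcast ⊢
    rw [add_sub_cancel_right, hcast]

lemma Vdens_smul {m : ℕ} (θ a : ℝ) {c : ℝ} (hc : 0 < c) {x : Fin m → ℝ} (hx : x ∈ orthant m) :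
    Vdens m θ a (c • x) = c ^ (dPar m θ a - m) * Vdens m θ a x := by
  have hpair : ∀ p : Fin m × Fin m,
      (c * x p.1 - c * x p.2) / (c * x p.1 + c * x p.2) * ((c * x p.1) ^ θ - (c * x p.2) ^ θ)
        = c ^ θ * ((x p.1 - x p.2) / (x p.1 + x p.2) * (x p.1 ^ θ - x p.2 ^ θ)) := by
    intro p
    rw [Real.mul_rpow hc.le (hx _), Real.mul_rpow hc.le (hx _), ← mul_sub, ← mul_add, ← mul_sub,
      mul_div_mul_left _ _ hc.ne']
    ring
  have hexp : c ^ (dPar m θ a - m)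
      = (c ^ θ) ^ (Finset.univ.filter fun p : Fin m × Fin m => p.1 < p.2).card * (c ^ a) ^ m := by
    rw [← Real.rpow_natCast, ← Real.rpow_natCast, ← Real.rpow_mul hc.le, ← Real.rpow_mul hc.le,
      ← Real.rpow_add hc, card_filter_fst_lt_snd, dPar]
    ring_nf
  have hprod : ∏ i, (c * x i) ^ a = (c ^ a) ^ m * ∏ i, x i ^ a := by
    simp [Real.mul_rpow hc.le (hx _), Finset.prod_mul_distrib]
  simp only [Vdens, Pi.smul_apply, smul_eq_mul, hpair, hprod, hexp]
  rw [Finset.prod_mul_distrib, Finset.prod_const, mul_mul_mul_comm]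

lemma integrableOn_rpow_mul_exp_mul_one_add_rpow_pow {θ a : ℝ} (hθ : 0 < θ) (ha : -1 < a) (n : ℕ) :
    IntegrableOn (fun t : ℝ => t ^ a * Real.exp (-t) * (1 + t ^ θ) ^ n) (Set.Ioi 0) := by
  have h1 := Real.GammaIntegral_convergent (s := a + 1) (by linarith)
  have h2 := Real.GammaIntegral_convergent (s := a + θ * n + 1)
    (by have : 0 ≤ θ * n := by positivity
        linarith)
  refine Integrable.mono' ((h1.add h2).const_mul (2 ^ (n - 1))) (by fun_prop) ?_
  filter_upwards [self_mem_ae_restrict measurableSet_Ioi] with t (ht : 0 < t)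
  rw [Real.norm_of_nonneg (by positivity)]
  have h := add_pow_le zero_le_one (Real.rpow_nonneg ht.le θ) n
  calc t ^ a * Real.exp (-t) * (1 + t ^ θ) ^ n
      ≤ t ^ a * Real.exp (-t) * (2 ^ (n - 1) * (1 ^ n + (t ^ θ) ^ n)) := by gcongr
    _ = _ := by
      simp only [Pi.add_apply, add_sub_cancel_right, one_pow]
      rw [Real.rpow_add ht, Real.rpow_mul ht.le, Real.rpow_natCast]
      ring

lemma integrableOn_hWeight (m : ℕ) {θ a : ℝ} (hθ : 0 < θ) (ha : -1 < a) :
    IntegrableOn (hWeight m θ a) (orthant m) volume := by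
  have hbound : IntegrableOn
      (fun x : Fin m → ℝ => ∏ i, (x i ^ a * Real.exp (-x i) * (1 + x i ^ θ) ^ (m + m)))
      (univ.pi fun _ => Set.Ioi 0) volume := by
    rw [IntegrableOn, volume_pi, Measure.restrict_pi_pi]
    exact Integrable.fintype_prod fun _ =>
      integrableOn_rpow_mul_exp_mul_one_add_rpow_pow hθ ha (m + m)
  rw [IntegrableOn, ← restrict_orthant] at hbound
  refine Integrable.mono' hbound (measurable_hWeight m θ a).aestronglyMeasurable ?_
  filter_upwards [self_mem_ae_restrict (measurableSet_orthant m)] with x hx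
  have hone : ∀ i, 1 ≤ 1 + x i ^ θ := fun i => by
    linarith [Real.rpow_nonneg (hx i) θ]
  have hpairs : |∏ p ∈ Finset.univ.filter (fun p : Fin m × Fin m => p.1 < p.2),
      ((x p.1 - x p.2) / (x p.1 + x p.2) * (x p.1 ^ θ - x p.2 ^ θ))|
      ≤ ∏ i, (1 + x i ^ θ) ^ (m + m) := by
    rw [Finset.abs_prod]
    calc _ ≤ ∏ p ∈ Finset.univ.filter (fun p : Fin m × Fin m => p.1 < p.2),
          (1 + x p.1 ^ θ) * (1 + x p.2 ^ θ) :=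
          Finset.prod_le_prod (fun _ _ => abs_nonneg _) fun p _ => pair_factor_le (hx _) (hx _)
      _ ≤ ∏ p : Fin m × Fin m, (1 + x p.1 ^ θ) * (1 + x p.2 ^ θ) := by
          have h (p : Fin m × Fin m) : 1 ≤ (1 + x p.1 ^ θ) * (1 + x p.2 ^ θ) :=
            one_le_mul_of_one_le_of_one_le (hone _) (hone _)
          rw [Finset.prod_filter]
          refine Finset.prod_le_prod (fun p _ => ?_) fun p _ => ?_ <;> split_ifs
          exacts [zero_le_one.trans (h p), zero_le_one, le_rfl, h p]
      _ = ∏ i, (1 + x i ^ θ) ^ (m + m) := by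
          simp [Fintype.prod_prod_type, Finset.prod_mul_distrib, pow_add, Finset.prod_pow]
  have hnn : 0 ≤ ∏ i, x i ^ a * Real.exp (-(x i)) :=
    Finset.prod_nonneg fun i _ => mul_nonneg (Real.rpow_nonneg (hx i) a) (Real.exp_nonneg _)
  rw [Real.norm_eq_abs, hWeight, abs_mul, abs_of_nonneg hnn,
    Finset.prod_mul_distrib (g := fun i => (1 + x i ^ θ) ^ (m + m)), mul_comm]
  gcongr

lemma hWeight_pos {m : ℕ} {θ : ℝ} (hθ : 0 < θ) (a : ℝ) {x : Fin m → ℝ} (hx : ∀ i, 0 < x i)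
    (hmono : StrictMono x) : 0 < hWeight m θ a x := by
  refine mul_pos (Finset.prod_pos fun p hp => ?_) (Finset.prod_pos fun i _ => ?_)
  · have h := hmono (Finset.mem_filter.1 hp).2
    exact mul_pos_of_neg_of_neg (div_neg_of_neg_of_pos (sub_neg.2 h) (add_pos (hx _) (hx _)))
      (sub_neg.2 (Real.rpow_lt_rpow (hx _).le h hθ))
  · exact mul_pos (Real.rpow_pos_of_pos (hx i) a) (Real.exp_pos _)

lemma setIntegral_hWeight_pos (m : ℕ) {θ a : ℝ} (hθ : 0 < θ) (ha : -1 < a) :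
    0 < ∫ x in orthant m, hWeight m θ a x := by
  rw [setIntegral_pos_iff_support_of_nonneg_ae _ (integrableOn_hWeight m hθ ha)]
  swap
  · filter_upwards [self_mem_ae_restrict (measurableSet_orthant m)] with x hx
    exact hWeight_nonneg hθ a hx
  have hopen : IsOpen {x : Fin m → ℝ | (∀ i, 0 < x i) ∧ ∀ i j, i < j → x i < x j} := by
    simp only [Set.ofPred_and, Set.ofPred_forall]
    refine (isOpen_iInter_of_finite fun i => ?_).inter (isOpen_iInter_of_finite fun i =>
      isOpen_iInter_of_finite fun j => isOpen_iInter_of_finite fun _ => ?_)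
    · exact isOpen_lt continuous_const (continuous_apply i)
    · exact isOpen_lt (continuous_apply i) (continuous_apply j)
  have hne : {x : Fin m → ℝ | (∀ i, 0 < x i) ∧ ∀ i j, i < j → x i < x j}.Nonempty :=
    ⟨fun i => (i : ℝ) + 1, fun i => by positivity, fun i j hij => by
      have : (i : ℝ) < j := by exact_mod_cast hij
      linarith⟩
  refine (hopen.measure_pos volume hne).trans_le
    (measure_mono fun x hx => ⟨?_, fun i => (hx.1 i).le⟩)
  exact (hWeight_pos hθ a hx.1 fun i j => hx.2 i j).ne'

lemma dPar_pos {m : ℕ} (hm : 1 ≤ m) {θ a : ℝ} (hθ : 0 < θ) (ha : -1 < a) : 0 < dPar m θ a := by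
  have h1 : (1 : ℝ) ≤ m := by exact_mod_cast hm
  have h2 : 0 ≤ (m - 1) * θ := mul_nonneg (by linarith) hθ.le
  unfold dPar
  have : 0 < m * θ - θ + 2 * a + 2 := by linarith
  positivity

/-- The distribution of the trace under the unconstrained weight, for Lebesgue integrals. -/
lemma gamma_mul_setLIntegral_comp_sum_mul_Vdens {m : ℕ} (hm : 1 ≤ m) {θ a : ℝ} (hθ : 0 < θ)
    (ha : -1 < a) {ψ : ℝ → ENNReal} (hψ : Measurable ψ) :
    ENNReal.ofReal (Real.Gamma (dPar m θ a))
        * ∫⁻ x in orthant m, ψ (∑ i, x i) * ENNReal.ofReal (Vdens m θ a x)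
      = (∫⁻ x in orthant m, ENNReal.ofReal (hWeight m θ a x))
        * ∫⁻ r in Set.Ioi (0 : ℝ), ψ r * ENNReal.ofReal (r ^ (dPar m θ a - 1)) := by
  set P : Set (Fin m → ℝ) := univ.pi fun _ => Set.Ioi 0 with hP
  have hPm : MeasurableSet P := MeasurableSet.univ_pi fun _ => measurableSet_Ioi
  have hPo : P ⊆ orthant m := fun x hx i => (hx i (mem_univ i)).le
  have hne : (Finset.univ : Finset (Fin m)).Nonempty := ⟨⟨0, hm⟩, Finset.mem_univ _⟩
  have hsmul : ∀ c : ℝ, 0 < c → ∀ x, c • x ∈ P ↔ x ∈ P := fun c hc x => by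
    simp [hP, hc]
  have h := gamma_mul_lintegral_comp_mul_homogeneous (dPar_pos hm hθ ha)
    (s := fun x : Fin m → ℝ => ∑ i, x i) (by fun_prop)
    (fun c x => by simp [Finset.mul_sum])
    (w := P.indicator fun x => ENNReal.ofReal (Vdens m θ a x))
    ((measurable_Vdens m θ a).ennreal_ofReal.indicator hPm)
    (fun c hc x => by
      by_cases hx : x ∈ P
      · rw [indicator_of_mem hx, indicator_of_mem ((hsmul c hc x).2 hx), Vdens_smul θ a hc (hPo hx),
          ENNReal.ofReal_mul (by positivity)]
      · rw [indicator_of_notMem hx, indicator_of_notMem (mt (hsmul c hc x).1 hx), mul_zero])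
    (fun x hx => Finset.sum_pos (fun i _ => mem_of_indicator_ne_zero hx i (mem_univ i)) hne) hψ
  rw [restrict_orthant, ← lintegral_indicator hPm, ← lintegral_indicator hPm]
  have hl : (P.indicator fun x => ψ (∑ i, x i) * ENNReal.ofReal (Vdens m θ a x))
      = fun x => ψ (∑ i, x i) * P.indicator (fun x => ENNReal.ofReal (Vdens m θ a x)) x := by
    ext x
    by_cases hx : x ∈ P <;> simp [hx]
  have hr : (P.indicator fun x => ENNReal.ofReal (hWeight m θ a x))
      = fun x => P.indicator (fun x => ENNReal.ofReal (Vdens m θ a x)) x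
        * ENNReal.ofReal (Real.exp (-∑ i, x i)) := by
    ext x
    by_cases hx : x ∈ P
    · simp [hx, hWeight_eq_Vdens_mul_exp, ENNReal.ofReal_mul (Vdens_nonneg hθ a (hPo hx))]
    · simp [hx]
  rw [hl, hr, h]

/-- **The trace of the unconstrained interpolating ensemble is
Gamma-distributed.** For every integer `m ≥ 1` and reals `θ > 0`, `a > −1`,
with `d = m(mθ−θ+2a+2)/2`: the weight `h̃` is integrable on `[0,∞)^m` with
positive total mass, and for every Borel measurable `φ : (0,∞) → [0,∞)`,
`∫_{[0,∞)^m} φ(Σ x_i) h̃(x) dx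
  = (1/Γ(d)) (∫_{[0,∞)^m} h̃) ∫_0^∞ φ(r) r^{d−1} e^{−r} dr`. -/
theorem trace_gamma_distributed (m : ℕ) (hm : 1 ≤ m) (θ a : ℝ)
    (hθ : 0 < θ) (ha : -1 < a) :
    IntegrableOn (hWeight m θ a) (orthant m) volume ∧
    0 < ∫ x in orthant m, hWeight m θ a x ∧
    ∀ φ : ℝ → ℝ, Measurable φ → (∀ r, 0 < r → 0 ≤ φ r) →
      (∫ x in orthant m, φ (∑ i, x i) * hWeight m θ a x)
        = (1 / Real.Gamma (dPar m θ a)) * (∫ x in orthant m, hWeight m θ a x)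
            * ∫ r in Ioi (0 : ℝ), φ r * r ^ (dPar m θ a - 1) * Real.exp (-r) := by
  refine ⟨integrableOn_hWeight m hθ ha, setIntegral_hWeight_pos m hθ ha, fun φ hφ hφ0 => ?_⟩
  have hΓ := Real.Gamma_pos_of_pos (dPar_pos hm hθ ha)
  have key := congrArg ENNReal.toReal (gamma_mul_setLIntegral_comp_sum_mul_Vdens hm hθ ha
    (ψ := fun r => ENNReal.ofReal (φ r * Real.exp (-r))) (by fun_prop))
  have hpos : ∀ᵐ x ∂(volume : Measure (Fin m → ℝ)).restrict (orthant m),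
      x ∈ orthant m ∧ 0 < ∑ i, x i := by
    rw [restrict_orthant]
    filter_upwards [self_mem_ae_restrict
      (MeasurableSet.univ_pi fun _ => measurableSet_Ioi)] with x hx
    exact ⟨fun i => (hx i (mem_univ i)).le,
      Finset.sum_pos (fun i _ => hx i (mem_univ i)) ⟨⟨0, hm⟩, Finset.mem_univ _⟩⟩
  have hleft : ∫ x in orthant m, φ (∑ i, x i) * hWeight m θ a x
      = (∫⁻ x in orthant m, ENNReal.ofReal (φ (∑ i, x i) * Real.exp (-∑ i, x i))
        * ENNReal.ofReal (Vdens m θ a x)).toReal := by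
    rw [integral_eq_lintegral_of_nonneg_ae]
    · congr 1
      refine lintegral_congr_ae ?_
      filter_upwards [hpos] with x hx
      rw [← ENNReal.ofReal_mul (mul_nonneg (hφ0 _ hx.2) (Real.exp_nonneg _)),
        hWeight_eq_Vdens_mul_exp]
      ring_nf
    · filter_upwards [hpos] with x hx
      exact mul_nonneg (hφ0 _ hx.2) (hWeight_nonneg hθ a hx.1)
    · exact ((hφ.comp (by fun_prop)).mul (measurable_hWeight m θ a)).aestronglyMeasurable
  have hmass : ∫ x in orthant m, hWeight m θ a x
      = (∫⁻ x in orthant m, ENNReal.ofReal (hWeight m θ a x)).toReal := by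
    refine integral_eq_lintegral_of_nonneg_ae ?_ (measurable_hWeight m θ a).aestronglyMeasurable
    filter_upwards [hpos] with x hx
    exact hWeight_nonneg hθ a hx.1
  have hright : ∫ r in Set.Ioi (0 : ℝ), φ r * r ^ (dPar m θ a - 1) * Real.exp (-r)
      = (∫⁻ r in Set.Ioi (0 : ℝ), ENNReal.ofReal (φ r * Real.exp (-r))
        * ENNReal.ofReal (r ^ (dPar m θ a - 1))).toReal := by
    rw [integral_eq_lintegral_of_nonneg_ae]
    · congr 1
      refine setLIntegral_congr_fun measurableSet_Ioi fun r (hr : 0 < r) => ?_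
      rw [← ENNReal.ofReal_mul (mul_nonneg (hφ0 r hr) (Real.exp_nonneg _))]
      ring_nf
    · filter_upwards [self_mem_ae_restrict measurableSet_Ioi] with r (hr : 0 < r)
      exact mul_nonneg (mul_nonneg (hφ0 r hr) (Real.rpow_nonneg hr.le _)) (Real.exp_nonneg _)
    · exact Measurable.aestronglyMeasurable (by fun_prop)
  rw [ENNReal.toReal_mul, ENNReal.toReal_mul, ENNReal.toReal_ofReal hΓ.le, ← hleft, ← hmass,
    ← hright] at key
  rw [mul_assoc, ← key]
  field_simp

end
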